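/- Let y = v_j be a vertex. Call a left-pseudo-bipartite scenario s(i, ω) (with i > j) critical for y if ω ∈ {w_i^−, w_i^+} or the right-cluster partition for y under s(i, ·) is not locally constant at ω. Then the total number of distinct critical left-pseudo-bipartite scenarios for y is at most 2(n − j) + 1; in particular it is at most 2n. -/

import Mathlib

open Finset
open scoped Classical

namespace DPN

noncomputable def score (τ c : ℝ) (v w : ℕ → ℝ) (h r j : ℕ) : ℝ :=
  τ * (v h - v j) + (∑ l ∈ Finset.Ioc r j, w l) / c

noncomputable def nextHead (τ c : ℝ) (v w : ℕ → ℝ) (h r : ℕ) : ℕ :=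
  (((Finset.Ioc r h).filter (fun j =>
      ∀ j' ∈ Finset.Ioc r h, score τ c v w h r j' ≤ score τ c v w h r j)).max).getD h

noncomputable def heads (τ c : ℝ) (v w : ℕ → ℝ) (h : ℕ) : ℕ → ℕ
  | 0 => 0
  | m + 1 => nextHead τ c v w h (heads τ c v w h m)

noncomputable def hIdx (n : ℕ) (v : ℕ → ℝ) (x : ℝ) : ℕ :=
  ((Finset.Icc 1 n).filter (fun i => v i < x)).card

noncomputable def phiL (n : ℕ) (τ c : ℝ) (v w : ℕ → ℝ) (x : ℝ) : ℝ :=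
  ∑ m ∈ Finset.range n,
    ((∑ l ∈ Finset.Ioc (heads τ c v w (hIdx n v x) m) (heads τ c v w (hIdx n v x) (m + 1)), w l) *
        (τ * (x - v (heads τ c v w (hIdx n v x) (m + 1)))) +
      (∑ l ∈ Finset.Ioc (heads τ c v w (hIdx n v x) m) (heads τ c v w (hIdx n v x) (m + 1)), w l) ^ 2 /
        (2 * c))

def rv (n : ℕ) (v : ℕ → ℝ) : ℕ → ℝ := fun l => -v (n + 1 - l)

def rw (n : ℕ) (w : ℕ → ℝ) : ℕ → ℝ := fun l => w (n + 1 - l)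

noncomputable def phiR (n : ℕ) (τ c : ℝ) (v w : ℕ → ℝ) (x : ℝ) : ℝ :=
  phiL n τ c (rv n v) (rw n w) (-x)

noncomputable def phi (n : ℕ) (τ c : ℝ) (v w : ℕ → ℝ) (x : ℝ) : ℝ :=
  phiL n τ c v w x + phiR n τ c v w x

/-- The set of scenarios: each vertex weight lies in its interval. -/
def scenarios (n : ℕ) (wm wp : ℕ → ℝ) : Set (ℕ → ℝ) :=
  {s | ∀ i, 1 ≤ i → i ≤ n → wm i ≤ s i ∧ s i ≤ wp i}

/-- The gap `Γ^s(x, y) = Φ^s(x) − Φ^s(y)`. -/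
noncomputable def gap (n : ℕ) (τ c : ℝ) (v s : ℕ → ℝ) (x y : ℝ) : ℝ :=
  phi n τ c v s x - phi n τ c v s y

/-- The regret `R^s(x) = Φ^s(x) − Φ^s(m^s)` (`Φ^s(m^s)` = min of `Φ^s` on `[v_1, v_n]`). -/
noncomputable def regret (n : ℕ) (τ c : ℝ) (v s : ℕ → ℝ) (x : ℝ) : ℝ :=
  phi n τ c v s x - sInf ((fun z => phi n τ c v s z) '' Set.Icc (v 1) (v n))

/-- The maximum regret `R_max(x) = sup_{s ∈ S} R^s(x)`. -/
noncomputable def maxRegret (n : ℕ) (τ c : ℝ) (v wm wp : ℕ → ℝ) (x : ℝ) : ℝ :=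
  sSup {r | ∃ s ∈ scenarios n wm wp, r = regret n τ c v s x}

/-- The left-pseudo-bipartite scenario `s(i, w)`. -/
def pseudoBipL (wm wp : ℕ → ℝ) (i : ℕ) (w : ℝ) : ℕ → ℝ :=
  fun l => if l < i then wp l else if l = i then w else wm l

/-- The right-pseudo-bipartite scenario `s(i, w)`. -/
def pseudoBipR (wm wp : ℕ → ℝ) (i : ℕ) (w : ℝ) : ℕ → ℝ :=
  fun l => if l < i then wm l else if l = i then w else wp l

/-- The head `ρ_m` of the left cluster containing vertex `i`: the smallest cluster head `≥ i`. -/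
noncomputable def clusterHeadOf (τ c : ℝ) (v w : ℕ → ℝ) (h i : ℕ) : ℕ :=
  ((((Finset.range (h + 1)).image (heads τ c v w h)).filter (fun r => i ≤ r)).min).getD h

/-- The head `ρ_{m−1}` preceding the left cluster containing vertex `i`:
the largest cluster head `< i`. -/
noncomputable def prevClusterHeadOf (τ c : ℝ) (v w : ℕ → ℝ) (h i : ℕ) : ℕ :=
  ((((Finset.range (h + 1)).image (heads τ c v w h)).filter (fun r => r < i)).max).getD 0

/-- The weight `σ_m` of the left cluster containing vertex `i`. -/
noncomputable def clusterWeightOf (τ c : ℝ) (v w : ℕ → ℝ) (h i : ℕ) : ℝ :=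
  ∑ l ∈ Finset.Ioc (prevClusterHeadOf τ c v w h i) (clusterHeadOf τ c v w h i), w l

/-- The sequence of right cluster heads for the vertex `y = v_j`
(expressed in the coordinates of the reflected network). -/
noncomputable def rightHeads (n : ℕ) (τ c : ℝ) (v w : ℕ → ℝ) (j : ℕ) : ℕ → ℕ :=
  heads τ c (rv n v) (rw n w) (hIdx n (rv n v) (-(v j)))

/-- The sequence of left cluster heads for the vertex `y = v_j`. -/
noncomputable def leftHeads (n : ℕ) (τ c : ℝ) (v w : ℕ → ℝ) (j : ℕ) : ℕ → ℕ :=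
  heads τ c v w (hIdx n v (v j))

/-- The (original-coordinates) index of the head of the right cluster for `y = v_j`
containing vertex `i`. -/
noncomputable def rightClusterHeadOf (n : ℕ) (τ c : ℝ) (v w : ℕ → ℝ) (j i : ℕ) : ℕ :=
  n + 1 - clusterHeadOf τ c (rv n v) (rw n w) (hIdx n (rv n v) (-(v j))) (n + 1 - i)

/-- The weight of the right cluster for `y = v_j` containing vertex `i`. -/
noncomputable def rightClusterWeightOf (n : ℕ) (τ c : ℝ) (v w : ℕ → ℝ) (j i : ℕ) : ℝ :=
  clusterWeightOf τ c (rv n v) (rw n w) (hIdx n (rv n v) (-(v j))) (n + 1 - i)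

/-- `ω` is a critical weight for `v_i` with respect to the vertex `y = v_j`
(left-pseudo-bipartite case): `ω ∈ {w_i^−, w_i^+}` or the right-cluster partition for `y`
under `s(i, ·)` is not constant on any neighborhood of `ω` in `[w_i^−, w_i^+]`. -/
def criticalWeightL (n : ℕ) (τ c : ℝ) (v wm wp : ℕ → ℝ) (j i : ℕ) (ω : ℝ) : Prop :=
  ω ∈ Set.Icc (wm i) (wp i) ∧
    (ω = wm i ∨ ω = wp i ∨
      ¬ ∃ ε > (0 : ℝ), ∀ w ∈ Set.Icc (wm i) (wp i), |w - ω| < ε →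
        rightHeads n τ c v (pseudoBipL wm wp i w) j =
          rightHeads n τ c v (pseudoBipL wm wp i ω) j)

/-- `ω` is a critical weight for `v_i` with respect to the vertex `y = v_j`
(right-pseudo-bipartite case, using the left-cluster partition for `y`). -/
def criticalWeightR (n : ℕ) (τ c : ℝ) (v wm wp : ℕ → ℝ) (j i : ℕ) (ω : ℝ) : Prop :=
  ω ∈ Set.Icc (wm i) (wp i) ∧
    (ω = wm i ∨ ω = wp i ∨
      ¬ ∃ ε > (0 : ℝ), ∀ w ∈ Set.Icc (wm i) (wp i), |w - ω| < ε →
        leftHeads n τ c v (pseudoBipR wm wp i w) j =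
          leftHeads n τ c v (pseudoBipR wm wp i ω) j)

/-- `Q`: the number of right clusters for `y = v_j` under weights `w` that lie entirely
to the right of the right cluster containing `v_i` (counted via reflected cluster heads). -/
noncomputable def Qnum (n : ℕ) (τ c : ℝ) (v w : ℕ → ℝ) (j i : ℕ) : ℕ :=
  (((Finset.range (n + 1)).image (rightHeads n τ c v w j)).filter
      (fun r => 1 ≤ r ∧
        r < clusterHeadOf τ c (rv n v) (rw n w) (hIdx n (rv n v) (-(v j))) (n + 1 - i))).card

end DPN

open DPN

namespace DPN

/-- Vertex `l` strictly dominates, in the cluster-defining score, every vertex of `(l, h]`. -/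
def IsRecord (τ c : ℝ) (v w : ℕ → ℝ) (h l : ℕ) : Prop :=
  ∀ l' ∈ Finset.Ioc l h, (∑ p ∈ Finset.Ioc l l', w p) / c < τ * (v l' - v l)

lemma score_sub_score (τ c : ℝ) (v w : ℕ → ℝ) (h : ℕ) {r l l' : ℕ} (hr : r ≤ l) (hl : l ≤ l') :
    score τ c v w h r l - score τ c v w h r l' =
      τ * (v l' - v l) - (∑ p ∈ Finset.Ioc l l', w p) / c := by
  have := Finset.sum_Ioc_consecutive w hr hl
  simp only [score, ← this]
  ring

lemma nextHead_of_le (τ c : ℝ) (v w : ℕ → ℝ) {h r : ℕ} (hr : h ≤ r) :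
    nextHead τ c v w h r = h := by
  simp only [nextHead, Finset.Ioc_eq_empty_of_le hr, Finset.filter_empty, Finset.max_empty]
  rfl

/-- The next cluster head is the first record after `r`. -/
lemma nextHead_spec (τ c : ℝ) (v w : ℕ → ℝ) {h r : ℕ} (hr : r < h) :
    nextHead τ c v w h r ∈ Finset.Ioc r h ∧ IsRecord τ c v w h (nextHead τ c v w h r) ∧
      ∀ l, r < l → l < nextHead τ c v w h r → ¬ IsRecord τ c v w h l := by
  set s := (Finset.Ioc r h).filter (fun j =>
      ∀ j' ∈ Finset.Ioc r h, score τ c v w h r j' ≤ score τ c v w h r j) with hs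
  have hne : s.Nonempty := by
    obtain ⟨m, hm, hmax⟩ := Finset.exists_max_image (Finset.Ioc r h) (score τ c v w h r)
      ⟨h, by simp [hr]⟩
    exact ⟨m, by simpa only [hs, Finset.mem_filter] using ⟨hm, hmax⟩⟩
  have hmax : nextHead τ c v w h r = s.max' hne := by
    simp only [nextHead, ← hs, ← Finset.coe_max' hne]
    rfl
  have hmem : nextHead τ c v w h r ∈ s := hmax ▸ s.max'_mem hne
  have hlast : ∀ l ∈ s, l ≤ nextHead τ c v w h r := fun l hl => hmax ▸ s.le_max' l hl
  generalize nextHead τ c v w h r = m at hmem hlast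
  obtain ⟨hm, hbest⟩ := Finset.mem_filter.1 hmem
  have hm' := Finset.mem_Ioc.1 hm
  refine ⟨hm, fun l' hl' => ?_, fun l hl hlm hrec => ?_⟩
  · have hl := Finset.mem_Ioc.1 hl'
    by_contra! hle
    have hsub := score_sub_score τ c v w h hm'.1.le hl.1.le
    have : l' ∈ s := by
      refine Finset.mem_filter.2 ⟨Finset.mem_Ioc.2 ⟨by omega, hl.2⟩, fun k hk => ?_⟩
      linarith [hbest k hk]
    exact absurd (hlast l' this) (by omega)
  · have h1 := hrec m (Finset.mem_Ioc.2 ⟨hlm, hm'.2⟩)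
    have hsub := score_sub_score τ c v w h hl.le hlm.le
    linarith [hbest l (Finset.mem_Ioc.2 ⟨hl, by omega⟩)]

lemma heads_congr (τ c : ℝ) (v w w' : ℕ → ℝ) (h : ℕ)
    (hrec : ∀ l ∈ Finset.Icc 1 h, IsRecord τ c v w h l ↔ IsRecord τ c v w' h l) :
    heads τ c v w h = heads τ c v w' h := by
  have hnext : ∀ r, nextHead τ c v w h r = nextHead τ c v w' h r := by
    intro r
    rcases le_or_gt h r with hr | hr
    · rw [nextHead_of_le τ c v w hr, nextHead_of_le τ c v w' hr]
    obtain ⟨h1, h2, h3⟩ := nextHead_spec τ c v w hr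
    obtain ⟨h1', h2', h3'⟩ := nextHead_spec τ c v w' hr
    rw [Finset.mem_Ioc] at h1 h1'
    refine le_antisymm (not_lt.1 fun hlt => ?_) (not_lt.1 fun hlt => ?_)
    · exact h3 _ h1'.1 hlt ((hrec _ (Finset.mem_Icc.2 ⟨by omega, h1'.2⟩)).2 h2')
    · exact h3' _ h1.1 hlt ((hrec _ (Finset.mem_Icc.2 ⟨by omega, h1.2⟩)).1 h2)
  funext m
  induction m with
  | zero => rfl
  | succ m ih => simp only [heads, ih, hnext]

lemma IsRecord.anti {τ c : ℝ} (hc : 0 < c) {v w w' : ℕ → ℝ} {h l : ℕ}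
    (hw : ∀ p ∈ Finset.Icc 1 h, w p ≤ w' p) (hrec : IsRecord τ c v w' h l) :
    IsRecord τ c v w h l := by
  intro l' hl'
  refine lt_of_le_of_lt ?_ (hrec l' hl')
  gcongr with p hp
  rw [Finset.mem_Ioc] at hp hl'
  exact hw p (Finset.mem_Icc.2 ⟨by omega, by omega⟩)

lemma hIdx_reflected_le {n : ℕ} {v : ℕ → ℝ} (hv : ∀ i, 1 ≤ i → i < n → v i < v (i + 1))
    {j : ℕ} (hjn : j ≤ n) : hIdx n (rv n v) (-(v j)) ≤ n - j := by
  have hmono : ∀ a, 1 ≤ a → ∀ b, a ≤ b → b ≤ n → v a ≤ v b := by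
    intro a ha b hab
    induction b, hab using Nat.le_induction with
    | base => exact fun _ => le_rfl
    | succ b hab ih => exact fun hb => (ih (by omega)).trans (hv b (by omega) (by omega)).le
  have hsub : (Finset.Icc 1 n).filter (fun i => rv n v i < -(v j)) ⊆ Finset.Icc 1 (n - j) := by
    intro i hi
    obtain ⟨hi, hlt⟩ := Finset.mem_filter.1 hi
    rw [Finset.mem_Icc] at hi ⊢
    refine ⟨hi.1, ?_⟩
    by_contra! hcon
    have := hmono (n + 1 - i) (by omega) j (by omega) hjn
    simp only [rv] at hlt
    linarith
  simpa [hIdx] using Finset.card_le_card hsub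

lemma pseudoBipL_mono {n : ℕ} {wm wp : ℕ → ℝ} (hwmp : ∀ i, 1 ≤ i → i ≤ n → wm i ≤ wp i)
    {i i' : ℕ} {ω ω' : ℝ} (hω : ω ∈ Set.Icc (wm i) (wp i)) (hω' : ω' ∈ Set.Icc (wm i') (wp i'))
    (hle : i < i' ∨ i = i' ∧ ω ≤ ω') {l : ℕ} (hl : 1 ≤ l) (hln : l ≤ n) :
    pseudoBipL wm wp i ω l ≤ pseudoBipL wm wp i' ω' l := by
  have := hwmp l hl hln
  obtain ⟨h1, h2⟩ := hω
  obtain ⟨h1', h2'⟩ := hω'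
  simp only [pseudoBipL]
  split_ifs <;> first | omega | (subst_vars; linarith) | skip
  rcases hle with hle | hle
  · omega
  · exact hle.2

/-- Whether `l` is a record is not locally constant at the scenario `s(i, ω)`. -/
def RecordJump (n : ℕ) (τ c : ℝ) (v wm wp : ℕ → ℝ) (h l i : ℕ) (ω : ℝ) : Prop :=
  ω ∈ Set.Icc (wm i) (wp i) ∧ ∀ ε > (0 : ℝ), ∃ w ∈ Set.Icc (wm i) (wp i), |w - ω| < ε ∧
    ¬ (IsRecord τ c (rv n v) (rw n (pseudoBipL wm wp i w)) h l ↔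
      IsRecord τ c (rv n v) (rw n (pseudoBipL wm wp i ω)) h l)

lemma RecordJump.exists_near {n : ℕ} {τ c : ℝ} {v wm wp : ℕ → ℝ} {h l i : ℕ} {ω : ℝ}
    (hb : RecordJump n τ c v wm wp h l i ω) {ε : ℝ} (hε : 0 < ε) :
    (∃ w ∈ Set.Icc (wm i) (wp i), |w - ω| < ε ∧
      IsRecord τ c (rv n v) (rw n (pseudoBipL wm wp i w)) h l) ∧
    ∃ w ∈ Set.Icc (wm i) (wp i), |w - ω| < ε ∧
      ¬ IsRecord τ c (rv n v) (rw n (pseudoBipL wm wp i w)) h l := by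
  obtain ⟨hω, hb⟩ := hb
  obtain ⟨w, hw, hwε, hne⟩ := hb ε hε
  have hωε : |ω - ω| < ε := by simpa using hε
  by_cases hrec : IsRecord τ c (rv n v) (rw n (pseudoBipL wm wp i ω)) h l
  · exact ⟨⟨ω, hω, hωε, hrec⟩, w, hw, hwε, fun h' => hne (iff_of_true h' hrec)⟩
  · exact ⟨⟨w, hw, hwε, by tauto⟩, ω, hω, hωε, hrec⟩

lemma RecordJump.not_lt {n : ℕ} {τ c : ℝ} (hc : 0 < c) {v wm wp : ℕ → ℝ}
    (hwmp : ∀ i, 1 ≤ i → i ≤ n → wm i ≤ wp i) {h : ℕ} (hh : h ≤ n) {l i i' : ℕ} {ω ω' : ℝ}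
    (hb : RecordJump n τ c v wm wp h l i ω) (hb' : RecordJump n τ c v wm wp h l i' ω') :
    ¬ (i < i' ∨ i = i' ∧ ω < ω') := by
  intro hlt
  obtain ⟨ε, hε, hgap⟩ : ∃ ε > (0 : ℝ), i < i' ∨ i = i' ∧ 2 * ε = ω' - ω := by
    rcases hlt with hlt | ⟨hi, hlt⟩
    · exact ⟨1, one_pos, Or.inl hlt⟩
    · exact ⟨(ω' - ω) / 2, by linarith, Or.inr ⟨hi, by ring⟩⟩
  obtain ⟨-, w, hw, hwε, hnot⟩ := hb.exists_near hε
  obtain ⟨⟨w', hw', hwε', hrec⟩, -⟩ := hb'.exists_near hε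
  refine hnot (hrec.anti hc fun p hp => ?_)
  rw [Finset.mem_Icc] at hp
  rw [abs_lt] at hwε hwε'
  exact pseudoBipL_mono hwmp hw hw' (hgap.imp_right fun hg => ⟨hg.1, by linarith [hg.2]⟩)
    (by omega) (by omega)

lemma RecordJump.unique {n : ℕ} {τ c : ℝ} (hc : 0 < c) {v wm wp : ℕ → ℝ}
    (hwmp : ∀ i, 1 ≤ i → i ≤ n → wm i ≤ wp i) {h : ℕ} (hh : h ≤ n) {l i i' : ℕ} {ω ω' : ℝ}
    (hb : RecordJump n τ c v wm wp h l i ω) (hb' : RecordJump n τ c v wm wp h l i' ω') :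
    i = i' ∧ ω = ω' := by
  have h1 := hb.not_lt hc hwmp hh hb'
  have h2 := hb'.not_lt hc hwmp hh hb
  push Not at h1 h2
  have hi : i = i' := le_antisymm h2.1 h1.1
  exact ⟨hi, le_antisymm (h2.2 hi.symm) (h1.2 hi)⟩

/-- A jump of the right-cluster partition is a jump of the record status of some vertex. -/
lemma exists_recordJump {n : ℕ} {τ c : ℝ} {v wm wp : ℕ → ℝ} {j i : ℕ} {ω : ℝ}
    (hω : ω ∈ Set.Icc (wm i) (wp i))
    (hcrit : ¬ ∃ ε > (0 : ℝ), ∀ w ∈ Set.Icc (wm i) (wp i), |w - ω| < ε →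
      rightHeads n τ c v (pseudoBipL wm wp i w) j =
        rightHeads n τ c v (pseudoBipL wm wp i ω) j) :
    ∃ l ∈ Finset.Icc 1 (hIdx n (rv n v) (-(v j))),
      RecordJump n τ c v wm wp (hIdx n (rv n v) (-(v j))) l i ω := by
  by_contra! hcon
  set h := hIdx n (rv n v) (-(v j)) with hh
  have hev : ∀ l ∈ Finset.Icc 1 h, ∀ᶠ ε in nhdsWithin (0 : ℝ) (Set.Ioi 0),
      ∀ w ∈ Set.Icc (wm i) (wp i), |w - ω| < ε →
        (IsRecord τ c (rv n v) (rw n (pseudoBipL wm wp i w)) h l ↔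
          IsRecord τ c (rv n v) (rw n (pseudoBipL wm wp i ω)) h l) := by
    intro l hl
    have := hcon l hl
    simp only [RecordJump, not_and, not_forall] at this
    obtain ⟨ε₀, hε₀, hloc⟩ := this hω
    filter_upwards [Ioo_mem_nhdsGT hε₀] with ε hε w hw hwε
    by_contra hne
    exact hloc ⟨w, hw, hwε.trans hε.2, hne⟩
  obtain ⟨ε, hε, hpos⟩ :=
    (((Filter.eventually_all_finset _).2 hev).and self_mem_nhdsWithin).exists
  exact hcrit ⟨ε, hpos, fun w hw hwε => heads_congr _ _ _ _ _ _ fun l hl => hε l hl w hw hwε⟩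

lemma pseudoBipL_left (wm wp : ℕ → ℝ) {i : ℕ} (hi : 1 ≤ i) :
    pseudoBipL wm wp i (wm i) = fun l => if l ≤ i - 1 then wp l else wm l := by
  funext l
  simp only [pseudoBipL]
  split_ifs <;> first | omega | (subst_vars; rfl)

lemma pseudoBipL_right (wm wp : ℕ → ℝ) (i : ℕ) :
    pseudoBipL wm wp i (wp i) = fun l => if l ≤ i then wp l else wm l := by
  funext l
  simp only [pseudoBipL]
  split_ifs <;> first | omega | (subst_vars; rfl)

lemma exists_finset_criticalWeightL (n : ℕ) (τ c : ℝ) (hc : 0 < c) (v : ℕ → ℝ)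
    (hv : ∀ i, 1 ≤ i → i < n → v i < v (i + 1)) (wm wp : ℕ → ℝ)
    (hwmp : ∀ i, 1 ≤ i → i ≤ n → wm i ≤ wp i) (j : ℕ) (hjn : j ≤ n) :
    ∃ T : Finset (ℕ → ℝ), T.card ≤ 2 * (n - j) + 1 ∧
      {s : ℕ → ℝ | ∃ i, j < i ∧ i ≤ n ∧ ∃ ω, criticalWeightL n τ c v wm wp j i ω ∧
          s = pseudoBipL wm wp i ω} ⊆ T := by
  set h := hIdx n (rv n v) (-(v j)) with hh
  have hle : h ≤ n - j := hIdx_reflected_le hv hjn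
  have hjump : ∀ l, ∃ t : ℕ → ℝ, ∀ i ω, RecordJump n τ c v wm wp h l i ω →
      pseudoBipL wm wp i ω = t := by
    intro l
    by_cases hex : ∃ i ω, RecordJump n τ c v wm wp h l i ω
    · obtain ⟨i₀, ω₀, h₀⟩ := hex
      refine ⟨pseudoBipL wm wp i₀ ω₀, fun i ω hb => ?_⟩
      obtain ⟨rfl, rfl⟩ := hb.unique hc hwmp (by omega) h₀
      rfl
    · exact ⟨0, fun i ω hb => absurd ⟨i, ω, hb⟩ hex⟩
  choose g hg using hjump
  let e : ℕ → ℕ → ℝ := fun k l => if l ≤ k then wp l else wm l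
  refine ⟨(Finset.Icc j n).image e ∪ (Finset.Icc 1 h).image g, ?_, ?_⟩
  · have h1 := Finset.card_image_le (s := Finset.Icc j n) (f := e)
    have h2 := Finset.card_image_le (s := Finset.Icc 1 h) (f := g)
    have h3 := Finset.card_union_le ((Finset.Icc j n).image e) ((Finset.Icc 1 h).image g)
    rw [Nat.card_Icc] at h1 h2
    omega
  · rintro s ⟨i, hji, hin, ω, ⟨hω, hcrit⟩, rfl⟩
    rw [Finset.mem_coe, Finset.mem_union, Finset.mem_image, Finset.mem_image]
    rcases hcrit with rfl | rfl | hcrit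
    · exact Or.inl ⟨i - 1, Finset.mem_Icc.2 ⟨by omega, by omega⟩,
        (pseudoBipL_left wm wp (by omega)).symm⟩
    · exact Or.inl ⟨i, Finset.mem_Icc.2 ⟨by omega, hin⟩, (pseudoBipL_right wm wp i).symm⟩
    · obtain ⟨l, hl, hb⟩ := exists_recordJump hω hcrit
      exact Or.inr ⟨l, hl, (hg l i ω hb).symm⟩

end DPN

theorem stmt18 (n : ℕ) (τ c : ℝ) (hτ : 0 < τ) (hc : 0 < c) (v : ℕ → ℝ)
    (hv : ∀ i, 1 ≤ i → i < n → v i < v (i + 1))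
    (wm wp : ℕ → ℝ) (hwm : ∀ i, 1 ≤ i → i ≤ n → 0 < wm i)
    (hwmp : ∀ i, 1 ≤ i → i ≤ n → wm i ≤ wp i)
    (j : ℕ) (hj1 : 1 ≤ j) (hjn : j ≤ n) :
    {s : ℕ → ℝ | ∃ i, j < i ∧ i ≤ n ∧
        ∃ ω, criticalWeightL n τ c v wm wp j i ω ∧
          s = pseudoBipL wm wp i ω}.Finite ∧
      {s : ℕ → ℝ | ∃ i, j < i ∧ i ≤ n ∧
        ∃ ω, criticalWeightL n τ c v wm wp j i ω ∧
          s = pseudoBipL wm wp i ω}.ncard ≤ 2 * (n - j) + 1 ∧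
      {s : ℕ → ℝ | ∃ i, j < i ∧ i ≤ n ∧
        ∃ ω, criticalWeightL n τ c v wm wp j i ω ∧
          s = pseudoBipL wm wp i ω}.ncard ≤ 2 * n := by
  obtain ⟨T, hT, hsub⟩ := exists_finset_criticalWeightL n τ c hc v hv wm wp hwmp j hjn
  have hcard := (Set.ncard_le_ncard hsub T.finite_toSet).trans
    ((Set.ncard_coe_finset T).le.trans hT)
  exact ⟨T.finite_toSet.subset hsub, hcard, hcard.trans (by omega)⟩
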